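/- arXiv:2006.09098 — 5 statements merged into one kernel-verified Lean document; each statement's English description precedes it below -/
import Mathlib

section
/- Let D ⊂ ℝ² be a bounded open set and g : ℝ² → ℝ continuously differentiable, with G = {x ∈ D : g(x) = 0}. Assume ∇g(x) ≠ 0 for every x ∈ G and g(x) > 0 for every x ∈ ∂D. Then for every x₀ ∈ G there exist T > 0 and a continuously differentiable function z = (z₁, z₂) : ℝ → ℝ² such that z(0) = x₀, z₁′(t) = −∂g/∂x₂(z(t)) and z₂′(t) = ∂g/∂x₁(z(t)) for all t ∈ ℝ, z(t) ∈ G for all t ∈ ℝ, and z(t + T) = z(t) for all t ∈ ℝ (i.e. the solution of the Hamiltonian system associated to g through x₀ is global and periodic). -/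
open Set Filter Topology

/-- `e` is a chart straightening the vector field `X` along the curve `G`: it maps `G` to the
first coordinate axis and `X` to the constant field `(1, 0)`. -/
structure IsFlowBox (X : ℝ × ℝ → ℝ × ℝ) (G : Set (ℝ × ℝ))
    (e : OpenPartialHomeomorph (ℝ × ℝ) (ℝ × ℝ)) : Prop where
  mem_iff : ∀ x ∈ e.source, x ∈ G ↔ (e x).2 = 0
  hasFDerivAt : ∀ x ∈ e.source, x ∈ G →
    ∃ e' : (ℝ × ℝ) ≃L[ℝ] (ℝ × ℝ), HasFDerivAt e (e' : ℝ × ℝ →L[ℝ] ℝ × ℝ) x ∧ e' (X x) = (1, 0)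

/-- `z` is an integral curve of `X` on `I` with values in `G`. -/
def IsCurveOn (X : ℝ × ℝ → ℝ × ℝ) (G : Set (ℝ × ℝ)) (z : ℝ → ℝ × ℝ) (I : Set ℝ) : Prop :=
  ∀ t ∈ I, HasDerivAt z (X (z t)) t ∧ z t ∈ G

/-- The Hamiltonian vector field of `g`. -/
noncomputable def hamiltonianField (g : ℝ × ℝ → ℝ) (x : ℝ × ℝ) : ℝ × ℝ :=
  (-(fderiv ℝ g x (0, 1)), fderiv ℝ g x (1, 0))

theorem ContinuousLinearMap.exists_equiv_of_injective (f : ℝ × ℝ →L[ℝ] ℝ × ℝ)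
    (hf : Function.Injective f) :
    ∃ e : (ℝ × ℝ) ≃L[ℝ] (ℝ × ℝ), (e : ℝ × ℝ →L[ℝ] ℝ × ℝ) = f := by
  refine ⟨(LinearEquiv.ofInjectiveEndo (f : ℝ × ℝ →ₗ[ℝ] ℝ × ℝ) hf).toContinuousLinearEquiv, ?_⟩
  ext1 <;> ext1 <;> rfl

/-- Inverse function theorem, with domain contained in a prescribed open set. -/
theorem exists_chart {F : ℝ × ℝ → ℝ × ℝ} (hF : ContDiff ℝ 1 F) {p : ℝ × ℝ} {W : Set (ℝ × ℝ)}
    (hW : IsOpen W) (hp : p ∈ W) (hinj : Function.Injective (fderiv ℝ F p)) :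
    ∃ e : OpenPartialHomeomorph (ℝ × ℝ) (ℝ × ℝ), p ∈ e.source ∧ e.source ⊆ W ∧ ⇑e = F := by
  obtain ⟨f', hf'⟩ := ContinuousLinearMap.exists_equiv_of_injective _ hinj
  have hd : HasFDerivAt F (f' : ℝ × ℝ →L[ℝ] ℝ × ℝ) p := by
    rw [hf']; exact (hF.differentiable one_ne_zero p).hasFDerivAt
  let e := (hF.contDiffAt (x := p)).toOpenPartialHomeomorph F hd one_ne_zero
  refine ⟨e.restrOpen W hW, ?_, ?_, ?_⟩
  · rw [OpenPartialHomeomorph.restrOpen_source]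
    exact ⟨(hF.contDiffAt (x := p)).mem_toOpenPartialHomeomorph_source hd one_ne_zero, hp⟩
  · rw [OpenPartialHomeomorph.restrOpen_source]
    exact inter_subset_right
  · exact (hF.contDiffAt (x := p)).toOpenPartialHomeomorph_coe hd one_ne_zero

theorem fderiv_hamiltonianField (g : ℝ × ℝ → ℝ) (x : ℝ × ℝ) :
    fderiv ℝ g x (hamiltonianField g x) = 0 := by
  have h : hamiltonianField g x
      = (-(fderiv ℝ g x (0, 1))) • ((1, 0) : ℝ × ℝ) + (fderiv ℝ g x (1, 0)) • ((0, 1) : ℝ × ℝ) := by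
    simp [hamiltonianField]
  rw [h, map_add, map_smul, map_smul]
  simp only [smul_eq_mul]
  ring

theorem continuous_hamiltonianField {g : ℝ × ℝ → ℝ} (hg : ContDiff ℝ 1 g) :
    Continuous (hamiltonianField g) := by
  have h := hg.continuous_fderiv one_ne_zero
  unfold hamiltonianField
  fun_prop

theorem injective_prod_of_apply_hamiltonianField_ne_zero {g : ℝ × ℝ → ℝ} {l : ℝ × ℝ →L[ℝ] ℝ}
    {x : ℝ × ℝ} (h : l (hamiltonianField g x) ≠ 0) {b : ℝ} (hb : b ≠ 0) :
    Function.Injective ((b • l).prod (fderiv ℝ g x)) := by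
  rw [injective_iff_map_eq_zero]
  rintro ⟨v, w⟩ hv
  have key : ∀ (f : ℝ × ℝ →L[ℝ] ℝ) (s t : ℝ), f (s, t) = s * f (1, 0) + t * f (0, 1) := by
    intro f s t
    have : ((s, t) : ℝ × ℝ) = s • ((1, 0) : ℝ × ℝ) + t • ((0, 1) : ℝ × ℝ) := by simp
    rw [this, map_add, map_smul, map_smul]
    rfl
  simp only [ContinuousLinearMap.prod_apply, smul_apply, smul_eq_mul,
    Prod.mk_eq_zero, mul_eq_zero, hb, false_or] at hv
  obtain ⟨h1, h2⟩ := hv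
  rw [key] at h1 h2
  rw [hamiltonianField, key] at h
  have hv : v * (-(fderiv ℝ g x (0, 1)) * l (1, 0) + fderiv ℝ g x (1, 0) * l (0, 1)) = 0 := by
    linear_combination -(fderiv ℝ g x (0, 1)) * h1 + l (0, 1) * h2
  have hw : w * (-(fderiv ℝ g x (0, 1)) * l (1, 0) + fderiv ℝ g x (1, 0) * l (0, 1)) = 0 := by
    linear_combination (fderiv ℝ g x (1, 0)) * h1 - l (1, 0) * h2
  simpa using ⟨(mul_eq_zero.1 hv).resolve_right h, (mul_eq_zero.1 hw).resolve_right h⟩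

theorem exists_isFlowBox {D : Set (ℝ × ℝ)} (hD : IsOpen D) {g : ℝ × ℝ → ℝ} (hg : ContDiff ℝ 1 g)
    {p : ℝ × ℝ} (hpD : p ∈ D) (hgp : g p = 0) (hp : fderiv ℝ g p ≠ 0) :
    ∃ e, IsFlowBox (hamiltonianField g) {x ∈ D | g x = 0} e ∧ p ∈ e.source ∧ e p = 0 := by
  set X := hamiltonianField g with hX
  have hXc : Continuous X := continuous_hamiltonianField hg
  let l : ℝ × ℝ →L[ℝ] ℝ :=
    (X p).1 • ContinuousLinearMap.fst ℝ ℝ ℝ + (X p).2 • ContinuousLinearMap.snd ℝ ℝ ℝ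
  have hlp : 0 < l (X p) := by
    have h0 : l (X p) = (fderiv ℝ g p (0, 1)) ^ 2 + (fderiv ℝ g p (1, 0)) ^ 2 := by
      simp [l, hX, hamiltonianField]; ring
    rw [h0]
    by_contra hcon
    apply hp
    have h1 : fderiv ℝ g p (0, 1) = 0 := by
      nlinarith [sq_nonneg (fderiv ℝ g p (0, 1)), sq_nonneg (fderiv ℝ g p (1, 0))]
    have h2 : fderiv ℝ g p (1, 0) = 0 := by
      nlinarith [sq_nonneg (fderiv ℝ g p (0, 1)), sq_nonneg (fderiv ℝ g p (1, 0))]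
    ext <;> simp [h1, h2]
  have hfd : ∀ (τ : ℝ → ℝ) (b : ℝ) (x : ℝ × ℝ), HasDerivAt τ b (l x) →
      HasFDerivAt (fun y => (τ (l y), g y)) ((b • l).prod (fderiv ℝ g x)) x := by
    intro τ b x h
    exact (h.comp_hasFDerivAt x l.hasFDerivAt).prodMk
      (hg.differentiable one_ne_zero x).hasFDerivAt
  -- a chart with first coordinate `l`, used to parametrize the level curve
  have hW : IsOpen {x | 0 < l (X x)} := isOpen_lt continuous_const (by fun_prop)
  obtain ⟨e₁, hp₁, hs₁, he₁⟩ := exists_chart (F := fun y => (l y, g y)) (by fun_prop) hW hlp (by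
    have h := (hfd id 1 p (hasDerivAt_id _)).fderiv
    simp only [id_eq] at h
    rw [h]
    exact injective_prod_of_apply_hamiltonianField_ne_zero hlp.ne' one_ne_zero)
  have hep : e₁ p = (l p, 0) := by rw [he₁]; simp [hgp]
  have htgt : ∀ᶠ u in 𝓝 (l p), ((u, 0) : ℝ × ℝ) ∈ e₁.target := by
    have : Continuous fun u : ℝ => ((u, 0) : ℝ × ℝ) := by fun_prop
    refine this.continuousAt.eventually (e₁.open_target.mem_nhds ?_)
    change ((l p, 0) : ℝ × ℝ) ∈ e₁.target
    exact hep ▸ e₁.map_source hp₁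
  obtain ⟨r, hr, hrt⟩ := Metric.nhds_basis_closedBall.eventually_iff.1 htgt
  rw [Real.closedBall_eq_Icc] at hrt
  let a : ℝ → ℝ := fun u => (l (X (e₁.symm (u, 0))))⁻¹
  have hapos : ∀ u ∈ Icc (l p - r) (l p + r), 0 < a u := fun u hu =>
    inv_pos.2 (hs₁ (e₁.map_target (hrt hu)))
  have hac : ContinuousOn a (Icc (l p - r) (l p + r)) := by
    intro u hu
    have h1 : ContinuousAt (fun u : ℝ => e₁.symm (u, 0)) u :=
      ContinuousAt.comp (f := fun u : ℝ => ((u, 0) : ℝ × ℝ)) (e₁.continuousAt_symm (hrt hu))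
        (by fun_prop)
    have h2 : ContinuousAt (fun u : ℝ => l (X (e₁.symm (u, 0)))) u :=
      ContinuousAt.comp (g := fun y => l (X y)) (by fun_prop) h1
    exact (h2.inv₀ (inv_pos.1 (hapos u hu)).ne').continuousWithinAt
  have hle : l p - r ≤ l p + r := by linarith
  let b : ℝ → ℝ := IccExtend hle ((Icc (l p - r) (l p + r)).domRestrict a)
  have hbc : Continuous b := (continuousOn_iff_continuous_domRestrict.1 hac).Icc_extend'
  have hba : ∀ u ∈ Icc (l p - r) (l p + r), b u = a u := fun u hu =>
    IccExtend_of_mem hle _ hu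
  let τ : ℝ → ℝ := fun u => ∫ s in (l p)..u, b s
  have hτ : ∀ u, HasDerivAt τ (b u) u := fun u => (hbc.integral_hasStrictDerivAt _ u).hasDerivAt
  have hτc : ContDiff ℝ 1 τ := by
    rw [contDiff_one_iff_deriv]
    refine ⟨fun u => (hτ u).differentiableAt, ?_⟩
    rwa [show deriv τ = b from funext fun u => (hτ u).deriv]
  have hinj : ∀ x ∈ e₁.source, l x ∈ Ioo (l p - r) (l p + r) →
      Function.Injective ((b (l x) • l).prod (fderiv ℝ g x)) := fun x hx hlx =>
    injective_prod_of_apply_hamiltonianField_ne_zero (hs₁ hx).ne'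
      (by rw [hba _ (Ioo_subset_Icc_self hlx)]; exact (hapos _ (Ioo_subset_Icc_self hlx)).ne')
  have hpr : l p ∈ Ioo (l p - r) (l p + r) := ⟨by linarith, by linarith⟩
  obtain ⟨e, hpe, hse, he⟩ := exists_chart (F := fun y => (τ (l y), g y)) (p := p)
    (W := D ∩ e₁.source ∩ l ⁻¹' Ioo (l p - r) (l p + r)) (by fun_prop)
    ((hD.inter e₁.open_source).inter (isOpen_Ioo.preimage l.continuous)) ⟨⟨hpD, hp₁⟩, hpr⟩ (by
      rw [(hfd τ _ p (hτ _)).fderiv]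
      exact hinj p hp₁ hpr)
  refine ⟨e, ⟨?_, ?_⟩, hpe, ?_⟩
  · intro x hx
    rw [he]
    exact ⟨fun h => h.2, fun h => ⟨(hse hx).1.1, h⟩⟩
  · rintro x hx ⟨-, hgx⟩
    obtain ⟨⟨-, hx₁⟩, hlx⟩ := hse hx
    obtain ⟨e', he'⟩ := ContinuousLinearMap.exists_equiv_of_injective _ (hinj x hx₁ hlx)
    refine ⟨e', ?_, ?_⟩
    · rw [he', he]
      exact hfd τ _ x (hτ _)
    · have hex : e₁.symm (l x, 0) = x := by
        have h : e₁ x = (l x, 0) := by rw [he₁]; simp [hgx]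
        rw [← h, e₁.left_inv hx₁]
      have h1 : e' (X x) = ((b (l x) • l).prod (fderiv ℝ g x)) (X x) := by rw [← he']; rfl
      rw [h1, ContinuousLinearMap.prod_apply, hX, fderiv_hamiltonianField, ← hX,
        smul_apply, hba _ (Ioo_subset_Icc_self hlx)]
      simp only [a, hex, smul_eq_mul]
      rw [inv_mul_cancel₀ (hs₁ hx₁).ne']
  · rw [he]
    simp [τ, hgp]

section FlowBox

variable {X : ℝ × ℝ → ℝ × ℝ} {G : Set (ℝ × ℝ)} {e : OpenPartialHomeomorph (ℝ × ℝ) (ℝ × ℝ)}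
  {z w : ℝ → ℝ × ℝ} {I : Set ℝ}

theorem IsCurveOn.mono {J : Set ℝ} (hz : IsCurveOn X G z I) (h : J ⊆ I) : IsCurveOn X G z J :=
  fun t ht => hz t (h ht)

theorem IsCurveOn.comp_add_const (hz : IsCurveOn X G z I) (s : ℝ) :
    IsCurveOn X G (fun t => z (t + s)) ((fun t => t + s) ⁻¹' I) :=
  fun t ht => ⟨(hz _ ht).1.comp_add_const t s, (hz _ ht).2⟩

/-- A flow box turns integral curves into unit speed translations. -/
theorem IsFlowBox.apply_curve (he : IsFlowBox X G e) (hI : IsOpen I) (hIc : IsPreconnected I)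
    (hz : IsCurveOn X G z I) (hze : ∀ t ∈ I, z t ∈ e.source) {s t : ℝ} (hs : s ∈ I) (ht : t ∈ I) :
    e (z t) = e (z s) + (t - s, 0) := by
  have hd : ∀ u ∈ I, HasDerivAt (fun u => e (z u) - (u, (0 : ℝ))) 0 u := by
    intro u hu
    obtain ⟨e', he', hX⟩ := he.hasFDerivAt _ (hze u hu) (hz u hu).2
    have h1 := he'.comp_hasDerivAt u (hz u hu).1
    have h2 := h1.sub ((hasDerivAt_id u).prodMk (hasDerivAt_const u (0 : ℝ)))
    have h3 : (e' : ℝ × ℝ →L[ℝ] ℝ × ℝ) (X (z u)) = (1, 0) := hX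
    rw [h3, sub_self] at h2
    exact h2
  have h := hI.is_const_of_deriv_eq_zero hIc
    (fun u hu => (hd u hu).differentiableAt.differentiableWithinAt) (fun u hu => (hd u hu).deriv)
    ht hs
  rw [sub_eq_sub_iff_add_eq_add] at h
  have h' := eq_sub_of_add_eq h
  rw [h', add_sub_assoc]
  simp

theorem IsFlowBox.isCurveOn_symm (he : IsFlowBox X G e)
    (hI : ∀ t ∈ I, ((t, 0) : ℝ × ℝ) ∈ e.target) :
    IsCurveOn X G (fun t => e.symm (t, 0)) I := by
  intro t ht
  have hsrc := e.map_target (hI t ht)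
  have hG : e.symm (t, 0) ∈ G := by
    rw [he.mem_iff _ hsrc, e.right_inv (hI t ht)]
  refine ⟨?_, hG⟩
  obtain ⟨e', he', hX⟩ := he.hasFDerivAt _ hsrc hG
  have h1 := (e.hasFDerivAt_symm (hI t ht) he').comp_hasDerivAt t
    ((hasDerivAt_id t).prodMk (hasDerivAt_const t (0 : ℝ)))
  have h2 : (e'.symm : ℝ × ℝ →L[ℝ] ℝ × ℝ) (1, 0) = X (e.symm (t, 0)) := by
    rw [← hX]; exact e'.symm_apply_apply _
  rwa [h2] at h1

theorem IsCurveOn.eqOn (hG : ∀ p ∈ G, ∃ e, IsFlowBox X G e ∧ p ∈ e.source ∧ e p = 0)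
    (hI : IsOpen I) (hIc : IsPreconnected I) (hz : IsCurveOn X G z I) (hw : IsCurveOn X G w I)
    {t₀ : ℝ} (ht₀ : t₀ ∈ I) (h₀ : z t₀ = w t₀) : EqOn z w I := by
  have hloc : ∀ t ∈ I, z t = w t → z =ᶠ[𝓝 t] w := by
    intro t ht h
    obtain ⟨e, he, hp, -⟩ := hG _ (hz t ht).2
    have hU := e.open_source.mem_nhds hp
    have h1 : ∀ᶠ s in 𝓝 t, s ∈ I ∧ z s ∈ e.source ∧ w s ∈ e.source :=
      (hI.eventually_mem ht).and (((hz t ht).1.continuousAt.eventually hU).and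
        ((hw t ht).1.continuousAt.eventually (h ▸ hU)))
    obtain ⟨r, hr, hball⟩ := Metric.eventually_nhds_iff_ball.1 h1
    filter_upwards [Metric.ball_mem_nhds t hr] with s hs
    have hc := (convex_ball t r).isPreconnected
    have htr := Metric.mem_ball_self (x := t) hr
    have hz' := he.apply_curve Metric.isOpen_ball hc (hz.mono fun u hu => (hball u hu).1)
      (fun u hu => (hball u hu).2.1) htr hs
    have hw' := he.apply_curve Metric.isOpen_ball hc (hw.mono fun u hu => (hball u hu).1)
      (fun u hu => (hball u hu).2.2) htr hs
    exact e.injOn (hball s hs).2.1 (hball s hs).2.2 (by rw [hz', hw', h])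
  have hsub : I ⊆ {t | z =ᶠ[𝓝 t] w} := by
    refine hIc.subset_of_closure_inter_subset isOpen_setOfPred_eventually_nhds
      ⟨t₀, ht₀, hloc _ ht₀ h₀⟩ ?_
    rintro t ⟨ht, htI⟩
    refine hloc t htI ?_
    have hfr : ∃ᶠ s in 𝓝 t, z s = w s :=
      (mem_closure_iff_frequently.1 ht).mono fun s hs => hs.eq_of_nhds
    by_contra hne
    have hev : ∀ᶠ s in 𝓝 t, z s ≠ w s :=
      (hz t htI).1.continuousAt.ne_iff_eventually_ne (hw t htI).1.continuousAt |>.1 hne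
    exact hfr hev
  exact fun t ht => (hsub ht).eq_of_nhds

/-- Near a point `p ∈ G`, every point of `G` lies on an integral curve passing through `p` at a
nearby time. -/
theorem exists_nhds_curve_through (hG : ∀ p ∈ G, ∃ e, IsFlowBox X G e ∧ p ∈ e.source ∧ e p = 0)
    {p : ℝ × ℝ} (hp : p ∈ G) :
    ∃ r > 0, r ≤ 1 / 4 ∧ ∃ γ, γ 0 = p ∧ IsCurveOn X G γ (Ioo (-(2 * r)) (2 * r)) ∧
      ∀ᶠ q in 𝓝 p, q ∈ G → ∃ s ∈ Ioo (-r) r, γ s = q := by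
  obtain ⟨e, he, hpe, h0⟩ := hG p hp
  have htgt : ∀ᶠ u in 𝓝 (0 : ℝ), ((u, 0) : ℝ × ℝ) ∈ e.target := by
    have : Continuous fun u : ℝ => ((u, 0) : ℝ × ℝ) := by fun_prop
    refine this.continuousAt.eventually (e.open_target.mem_nhds ?_)
    change (0 : ℝ × ℝ) ∈ e.target
    exact h0 ▸ e.map_source hpe
  obtain ⟨ρ, hρ, hρt⟩ := Metric.eventually_nhds_iff_ball.1 htgt
  rw [Real.ball_eq_Ioo] at hρt
  obtain ⟨r, hr, hr4, hrρ⟩ : ∃ r > 0, r ≤ 1 / 4 ∧ 2 * r ≤ ρ :=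
    ⟨min (1 / 4) (ρ / 2), by positivity, min_le_left _ _, by
      linarith [min_le_right (1 / 4) (ρ / 2)]⟩
  refine ⟨r, hr, hr4, fun t => e.symm (t, 0), ?_, he.isCurveOn_symm fun t ht => hρt t ?_, ?_⟩
  · have : e p = ((0 : ℝ), (0 : ℝ)) := h0
    simp only
    rw [← this, e.left_inv hpe]
  · exact ⟨by linarith [ht.1], by linarith [ht.2]⟩
  · have hc : ContinuousAt (fun q => (e q).1) p := (e.continuousAt hpe).fst
    have hnear : ∀ᶠ q in 𝓝 p, (e q).1 ∈ Ioo (-r) r :=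
      hc.eventually (Ioo_mem_nhds (by simp [h0, hr]) (by simp [h0, hr]))
    filter_upwards [hnear, e.open_source.mem_nhds hpe] with q hq hqe hqG
    refine ⟨_, hq, ?_⟩
    have : e q = ((e q).1, 0) := Prod.ext rfl ((he.mem_iff q hqe).1 hqG)
    rw [← this, e.left_inv hqe]

theorem exists_uniform_curve (hG : ∀ p ∈ G, ∃ e, IsFlowBox X G e ∧ p ∈ e.source ∧ e p = 0)
    (hGc : IsCompact G) :
    ∃ ε > 0, ∀ q ∈ G, ∃ γ, γ 0 = q ∧ IsCurveOn X G γ (Ioo (-ε) ε) := by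
  suffices h : ∃ ε > 0, ∀ q ∈ G, q ∈ G → ∃ γ, γ 0 = q ∧ IsCurveOn X G γ (Ioo (-ε) ε) from
    h.imp fun ε h => ⟨h.1, fun q hq => h.2 q hq hq⟩
  refine hGc.induction_on
    (p := fun S => ∃ ε > 0, ∀ q ∈ S, q ∈ G → ∃ γ, γ 0 = q ∧ IsCurveOn X G γ (Ioo (-ε) ε))
    ⟨1, one_pos, by simp⟩ ?_ ?_ ?_
  · rintro S S' hS ⟨ε, hε, h⟩
    exact ⟨ε, hε, fun q hq => h q (hS hq)⟩
  · rintro S S' ⟨ε, hε, h⟩ ⟨ε', hε', h'⟩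
    refine ⟨min ε ε', lt_min hε hε', ?_⟩
    rintro q (hq | hq) hqG
    · obtain ⟨γ, h0, hγ⟩ := h q hq hqG
      exact ⟨γ, h0, hγ.mono (Ioo_subset_Ioo (neg_le_neg (min_le_left _ _)) (min_le_left _ _))⟩
    · obtain ⟨γ, h0, hγ⟩ := h' q hq hqG
      exact ⟨γ, h0, hγ.mono (Ioo_subset_Ioo (neg_le_neg (min_le_right _ _)) (min_le_right _ _))⟩
  · intro p hp
    obtain ⟨r, hr, -, γ, -, hγ, hnear⟩ := exists_nhds_curve_through hG hp
    refine ⟨_, mem_nhdsWithin_of_mem_nhds hnear, r, hr, fun q hq hqG => ?_⟩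
    obtain ⟨s, hs, hsq⟩ := hq hqG
    refine ⟨fun t => γ (t + s), by simpa using hsq, (hγ.comp_add_const s).mono fun t ht => ?_⟩
    exact ⟨by linarith [ht.1, hs.1], by linarith [ht.2, hs.2]⟩

theorem exists_global_curve (hG : ∀ p ∈ G, ∃ e, IsFlowBox X G e ∧ p ∈ e.source ∧ e p = 0)
    (hGc : IsCompact G) {q : ℝ × ℝ} (hq : q ∈ G) : ∃ z, z 0 = q ∧ IsCurveOn X G z univ := by
  obtain ⟨ε, hε, h⟩ := exists_uniform_curve hG hGc
  have h' : ∀ q : G, ∃ γ, γ 0 = (q : ℝ × ℝ) ∧ IsCurveOn X G γ (Ioo (-ε) ε) := fun q => h q q.2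
  choose Φ hΦ0 hΦ using h'
  have hsemi : ∀ (q q' : G) (s t : ℝ), s ∈ Ioo (-ε) ε → t ∈ Ioo (-ε) ε → t + s ∈ Ioo (-ε) ε →
      Φ q s = q' → Φ q' t = Φ q (t + s) := by
    intro q q' s t hs ht hts hq'
    have hpre : (fun t => t + s) ⁻¹' Ioo (-ε) ε = Ioo (-ε - s) (ε - s) := by simp
    have hopen : IsOpen (Ioo (-ε) ε ∩ Ioo (-ε - s) (ε - s)) := isOpen_Ioo.inter isOpen_Ioo
    have hconn : IsPreconnected (Ioo (-ε) ε ∩ Ioo (-ε - s) (ε - s)) :=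
      ((convex_Ioo _ _).inter (convex_Ioo _ _)).isPreconnected
    refine IsCurveOn.eqOn hG hopen hconn ((hΦ q').mono inter_subset_left)
      (((hΦ q).comp_add_const s).mono (hpre ▸ inter_subset_right)) (t₀ := 0) ?_ ?_ ?_
    · exact ⟨⟨by linarith, hε⟩, by linarith [hs.1], by linarith [hs.2]⟩
    · simp [hΦ0, hq']
    · exact ⟨ht, by linarith [hts.1], by linarith [hts.2]⟩
  obtain ⟨δ, hδ, hδε⟩ : ∃ δ > 0, δ < ε := exists_between hε
  have hδm : δ ∈ Ioo (-ε) ε := ⟨by linarith, hδε⟩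
  have hδm' : -δ ∈ Ioo (-ε) ε := ⟨by linarith, by linarith⟩
  have h0m : (0 : ℝ) ∈ Ioo (-ε) ε := ⟨by linarith, hε⟩
  let ψ : Equiv.Perm G :=
    { toFun := fun q => ⟨Φ q δ, (hΦ q δ hδm).2⟩
      invFun := fun q => ⟨Φ q (-δ), (hΦ q (-δ) hδm').2⟩
      left_inv := fun q => Subtype.ext <| by
        simp only
        rw [hsemi q ⟨Φ q δ, (hΦ q δ hδm).2⟩ δ (-δ) hδm hδm' (by simpa using h0m) rfl,
          neg_add_cancel, hΦ0]
      right_inv := fun q => Subtype.ext <| by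
        simp only
        rw [hsemi q ⟨Φ q (-δ), (hΦ q (-δ) hδm').2⟩ (-δ) δ hδm' hδm (by simpa using h0m) rfl,
          add_neg_cancel, hΦ0] }
  let c : ℤ → ℝ → ℝ × ℝ := fun n t => Φ ((ψ ^ n) ⟨q, hq⟩) (t - n * δ)
  have hc : ∀ t : ℝ, ∀ n : ℤ, t ∈ Ioo (n * δ - δ) (n * δ + δ) → c ⌊t / δ⌋ t = c n t := by
    intro t n ht
    rcases le_or_gt (n * δ) t with hle | hlt
    · have : ⌊t / δ⌋ = n := by
        rw [Int.floor_eq_iff, le_div_iff₀ hδ, div_lt_iff₀ hδ]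
        exact ⟨hle, by linarith [ht.2]⟩
      rw [this]
    · have : ⌊t / δ⌋ = n - 1 := by
        rw [Int.floor_eq_iff, le_div_iff₀ hδ, div_lt_iff₀ hδ]
        push_cast
        exact ⟨by linarith [ht.1], by linarith⟩
      rw [this]
      have hn : ψ ((ψ ^ (n - 1)) ⟨q, hq⟩) = (ψ ^ n) ⟨q, hq⟩ := by
        rw [← Equiv.Perm.mul_apply, ← zpow_one_add]
        congr 2; ring
      have h1 := hsemi ((ψ ^ (n - 1)) ⟨q, hq⟩) ((ψ ^ n) ⟨q, hq⟩) δ (t - n * δ) hδm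
        ⟨by linarith [ht.1], by linarith⟩ ⟨by linarith [ht.1], by linarith⟩
        (congrArg Subtype.val hn)
      simp only [c]
      rw [h1]
      congr 1; push_cast; ring
  refine ⟨fun t => c ⌊t / δ⌋ t, by simp [c, hΦ0], fun t _ => ?_⟩
  have ht : t ∈ Ioo (⌊t / δ⌋ * δ - δ) (⌊t / δ⌋ * δ + δ) := by
    have h1 := (le_div_iff₀ hδ).1 (Int.floor_le (t / δ))
    have h2 := (div_lt_iff₀ hδ).1 (Int.lt_floor_add_one (t / δ))
    exact ⟨by linarith, by linarith⟩
  have hcurve := (hΦ ((ψ ^ ⌊t / δ⌋) ⟨q, hq⟩)).comp_add_const (-(⌊t / δ⌋ * δ)) t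
    ⟨by linarith [ht.1], by linarith [ht.2]⟩
  simp only [← sub_eq_add_neg] at hcurve
  refine ⟨hcurve.1.congr_of_eventuallyEq ?_, hcurve.2⟩
  filter_upwards [Ioo_mem_nhds ht.1 ht.2] with s hs using hc s _ hs

theorem IsCurveOn.exists_periodic (hG : ∀ p ∈ G, ∃ e, IsFlowBox X G e ∧ p ∈ e.source ∧ e p = 0)
    (hGc : IsCompact G) (hz : IsCurveOn X G z univ) : ∃ T > 0, ∀ t, z (t + T) = z t := by
  obtain ⟨p, hp, φ, hφ, hlim⟩ := hGc.tendsto_subseq (x := fun n : ℕ => z n)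
    fun n => (hz n trivial).2
  obtain ⟨r, hr, hr4, γ, hγ0, hγ, hnear⟩ := exists_nhds_curve_through hG hp
  have hhit : ∀ u : ℝ, (∃ s ∈ Ioo (-r) r, γ s = z u) → ∃ v ∈ Ioo (u - r) (u + r), z v = p := by
    rintro u ⟨s, hs, hsu⟩
    refine ⟨u - s, ⟨by linarith [hs.2], by linarith [hs.1]⟩, ?_⟩
    have hz' : IsCurveOn X G (fun t => z (t + (u - s))) (Ioo (-(2 * r)) (2 * r)) :=
      (hz.comp_add_const (u - s)).mono (subset_univ _)
    have heq := hz'.eqOn hG isOpen_Ioo (convex_Ioo _ _).isPreconnected hγ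
      (t₀ := s) ⟨by linarith [hs.1], by linarith [hs.2]⟩ (by simp [hsu])
    have h0 := heq (x := 0) ⟨by linarith, by linarith⟩
    simpa [hγ0] using h0
  obtain ⟨N, hN⟩ := eventually_atTop.1 (hlim.eventually hnear)
  obtain ⟨a, ha, hza⟩ := hhit _ (hN N le_rfl (hz _ trivial).2)
  obtain ⟨b, hb, hzb⟩ := hhit _ (hN (N + 1) (Nat.le_succ N) (hz _ trivial).2)
  have hlt : (φ N : ℝ) + 1 ≤ φ (N + 1) := by exact_mod_cast hφ (Nat.lt_succ_self N)
  refine ⟨b - a, by linarith [ha.2, hb.1], fun t => ?_⟩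
  exact ((hz.comp_add_const (b - a)).mono (subset_univ _)).eqOn hG isOpen_univ isPreconnected_univ
    hz (t₀ := a) trivial (by simp [hza, hzb]) trivial

end FlowBox

/-- Global existence and periodicity of the Hamiltonian flow
associated to a level function `g` on a bounded open set `D ⊂ ℝ²`. -/
theorem periodic_hamiltonian_flow
    (D : Set (ℝ × ℝ)) (hD : IsOpen D) (hDb : Bornology.IsBounded D)
    (g : ℝ × ℝ → ℝ) (hg : ContDiff ℝ 1 g)
    (hgrad : ∀ x ∈ {x ∈ D | g x = 0}, fderiv ℝ g x ≠ 0)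
    (hbd : ∀ x ∈ frontier D, 0 < g x) :
    ∀ x₀ ∈ {x ∈ D | g x = 0},
      ∃ T > (0 : ℝ), ∃ z : ℝ → ℝ × ℝ, ContDiff ℝ 1 z ∧ z 0 = x₀ ∧
        (∀ t : ℝ, HasDerivAt z (-(fderiv ℝ g (z t) (0, 1)), fderiv ℝ g (z t) (1, 0)) t) ∧
        (∀ t : ℝ, z t ∈ {x ∈ D | g x = 0}) ∧
        (∀ t : ℝ, z (t + T) = z t) := by
  intro x₀ hx₀
  have hG : ∀ p ∈ {x ∈ D | g x = 0},
      ∃ e, IsFlowBox (hamiltonianField g) {x ∈ D | g x = 0} e ∧ p ∈ e.source ∧ e p = 0 :=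
    fun p hp => exists_isFlowBox hD hg hp.1 hp.2 (hgrad p hp)
  have hGc : IsCompact {x ∈ D | g x = 0} := by
    have hset : {x ∈ D | g x = 0} = closure D ∩ g ⁻¹' {0} := by
      ext x
      refine ⟨fun h => ⟨subset_closure h.1, h.2⟩, fun ⟨hx, hgx⟩ => ⟨?_, hgx⟩⟩
      by_contra hxD
      have := hbd x (by rw [hD.frontier_eq]; exact ⟨hx, hxD⟩)
      exact this.ne' hgx
    rw [hset]
    exact hDb.isCompact_closure.inter_right (isClosed_singleton.preimage hg.continuous)
  obtain ⟨z, hz0, hz⟩ := exists_global_curve hG hGc hx₀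
  obtain ⟨T, hT, hper⟩ := hz.exists_periodic hG hGc
  have hd : ∀ t, HasDerivAt z (hamiltonianField g (z t)) t := fun t => (hz t trivial).1
  refine ⟨T, hT, z, ?_, hz0, hd, fun t => (hz t trivial).2, hper⟩
  have hdiff : Differentiable ℝ z := fun t => (hd t).differentiableAt
  rw [contDiff_one_iff_deriv, funext fun t => (hd t).deriv]
  exact ⟨hdiff, (continuous_hamiltonianField hg).comp hdiff.continuous⟩
end

section
/- Let D ⊂ ℝ² be a bounded open set and g : ℝ² → ℝ continuously differentiable, with G = {x ∈ D : g(x) = 0}. Assume ∇g(x) ≠ 0 for every x ∈ G and g(x) > 0 for every x ∈ ∂D. Then the set G is compact and has only finitely many connected components. -/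
open Topology

/-- A level set of a map has arbitrarily small neighbourhoods with preconnected trace on the
level set, around every point where the map is a strict submersion. -/
theorem HasStrictFDerivAt.exists_mem_nhds_isPreconnected_inter_levelSet
    {E F : Type*} [NormedAddCommGroup E] [NormedSpace ℝ E] [CompleteSpace E]
    [NormedAddCommGroup F] [NormedSpace ℝ F] [FiniteDimensional ℝ F]
    {f : E → F} {f' : E →L[ℝ] F} {a : E} (hf : HasStrictFDerivAt f f' a) (hf' : f'.range = ⊤)
    (c : F) {U : Set E} (hU : U ∈ 𝓝 a) :
    ∃ V ∈ 𝓝 a, V ⊆ U ∧ IsPreconnected (V ∩ {x | f x = c}) := by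
  have : CompleteSpace F := FiniteDimensional.complete ℝ F
  set e := hf.implicitToOpenPartialHomeomorph f f' hf'
  have ha : a ∈ e.source := hf.mem_implicitToOpenPartialHomeomorph_source hf'
  have hfst (x : E) : (e x).1 = f x := hf.implicitToOpenPartialHomeomorph_fst hf' x
  obtain ⟨r, hr, hball⟩ : ∃ r > 0, Metric.ball (e a) r ⊆ e.target ∩ e.symm ⁻¹' U := by
    refine Metric.mem_nhds_iff.1 (Filter.inter_mem (e.open_target.mem_nhds (e.map_source ha)) ?_)
    refine (e.symm.continuousAt (e.map_source ha)).preimage_mem_nhds ?_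
    rwa [e.left_inv ha]
  refine ⟨e.source ∩ e ⁻¹' Metric.ball (e a) r, ?_, ?_, ?_⟩
  · exact Filter.inter_mem (e.open_source.mem_nhds ha)
      ((e.continuousAt ha).preimage_mem_nhds (Metric.ball_mem_nhds _ hr))
  · rintro x ⟨hx, hxr⟩
    simpa [e.left_inv hx] using (hball hxr).2
  · have hconv : Convex ℝ (Metric.ball (e a) r ∩ {p | p.1 = c}) :=
      (convex_ball _ _).inter
        ((convex_singleton c).linear_preimage (LinearMap.fst ℝ F f'.ker))
    have himage : e.source ∩ e ⁻¹' Metric.ball (e a) r ∩ {x | f x = c} =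
        e.symm '' (Metric.ball (e a) r ∩ {p | p.1 = c}) := by
      ext x
      constructor
      · rintro ⟨⟨hx, hxr⟩, hxc⟩
        exact ⟨e x, ⟨hxr, (hfst x).trans hxc⟩, e.left_inv hx⟩
      · rintro ⟨p, ⟨hp, hpc⟩, rfl⟩
        have hpt := (hball hp).1
        refine ⟨⟨e.map_target hpt, ?_⟩, ?_⟩
        · simpa [e.right_inv hpt] using hp
        · simpa [← hfst, e.right_inv hpt] using hpc
    rw [himage]
    exact hconv.isPreconnected.image _
      (e.continuousOn_symm.mono fun p hp => (hball hp.1).1)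

/-- The part of a level set in an open set is locally connected if the map is a strict submersion
at its points. -/
theorem IsOpen.locallyConnectedSpace_levelSet
    {E F : Type*} [NormedAddCommGroup E] [NormedSpace ℝ E] [CompleteSpace E]
    [NormedAddCommGroup F] [NormedSpace ℝ F] [FiniteDimensional ℝ F]
    {f : E → F} {f' : E → E →L[ℝ] F} {c : F} {D : Set E} (hD : IsOpen D)
    (hf : ∀ x ∈ D, f x = c → HasStrictFDerivAt f (f' x) x)
    (hf' : ∀ x ∈ D, f x = c → (f' x).range = ⊤) :
    LocallyConnectedSpace {x ∈ D | f x = c} := by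
  rw [locallyConnectedSpace_iff_connected_subsets]
  rintro ⟨x, hxD, hxc⟩ U hU
  obtain ⟨W, hW, hWU⟩ := (mem_nhds_subtype _ _ _).1 hU
  obtain ⟨V, hV, hVW, hVc⟩ :=
    (hf x hxD hxc).exists_mem_nhds_isPreconnected_inter_levelSet (hf' x hxD hxc) c
      (Filter.inter_mem hW (hD.mem_nhds hxD))
  refine ⟨Subtype.val ⁻¹' V, continuousAt_subtype_val.preimage_mem_nhds hV, ?_,
    fun y hy => hWU (hVW hy).1⟩
  rw [← IsInducing.subtypeVal.isPreconnected_image, Subtype.image_preimage_coe]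
  convert hVc using 1
  ext y
  exact ⟨fun h => ⟨h.2, h.1.2⟩, fun h => ⟨⟨(hVW h.1).2, h.2⟩, h.1⟩⟩

/-- The zero level set `G = {x ∈ D | g x = 0}` is compact and has
finitely many connected components. -/
theorem level_set_compact_finitely_many_components
    (D : Set (ℝ × ℝ)) (hD : IsOpen D) (hDb : Bornology.IsBounded D)
    (g : ℝ × ℝ → ℝ) (hg : ContDiff ℝ 1 g)
    (G : Set (ℝ × ℝ)) (hG : G = {x ∈ D | g x = 0})
    (hgrad : ∀ x ∈ G, fderiv ℝ g x ≠ 0)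
    (hbd : ∀ x ∈ frontier D, 0 < g x) :
    IsCompact G ∧ Finite (ConnectedComponents ↥G) := by
  subst hG
  have hclosure : {x ∈ D | g x = 0} = closure D ∩ g ⁻¹' {0} := by
    ext x
    refine ⟨fun h => ⟨subset_closure h.1, h.2⟩, fun h => ⟨?_, h.2⟩⟩
    by_contra hx
    exact (hbd x ⟨h.1, by rwa [hD.interior_eq]⟩).ne' h.2
  have hcompact : IsCompact {x ∈ D | g x = 0} := by
    rw [hclosure]
    exact hDb.isCompact_closure.inter_right (isClosed_singleton.preimage hg.continuous)
  have : LocallyConnectedSpace {x ∈ D | g x = 0} :=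
    hD.locallyConnectedSpace_levelSet
      (fun x _ _ => hg.contDiffAt.hasStrictFDerivAt one_ne_zero)
      (fun x hxD hx => LinearMap.range_eq_top.2 <| LinearMap.surjective fun h =>
        hgrad x ⟨hxD, hx⟩ (ContinuousLinearMap.coe_injective h))
  have : CompactSpace {x ∈ D | g x = 0} := isCompact_iff_compactSpace.1 hcompact
  exact ⟨hcompact, inferInstance⟩
end

section
/- Let D ⊂ ℝ² be a bounded open set and g : ℝ² → ℝ continuously differentiable, with G = {x ∈ D : g(x) = 0}. Assume ∇g(x) ≠ 0 for every x ∈ G and g(x) > 0 for every x ∈ ∂D. Define Ω_g = interior{x ∈ D : g(x) ≤ 0}. Then the topological boundary (frontier) of Ω_g equals G. -/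
/-- The boundary of `Ω_g = interior {x ∈ D | g x ≤ 0}` is the
zero level set `G = {x ∈ D | g x = 0}`. -/
theorem frontier_eq_level_set
    (D : Set (ℝ × ℝ)) (hD : IsOpen D) (hDb : Bornology.IsBounded D)
    (g : ℝ × ℝ → ℝ) (hg : ContDiff ℝ 1 g)
    (G : Set (ℝ × ℝ)) (hG : G = {x ∈ D | g x = 0})
    (hgrad : ∀ x ∈ G, fderiv ℝ g x ≠ 0)
    (hbd : ∀ x ∈ frontier D, 0 < g x) :
    frontier (interior {x ∈ D | g x ≤ 0}) = G := by
  subst hG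
  have hc : Continuous g := hg.continuous
  have hneg : D ∩ {x | g x < 0} ⊆ interior {x ∈ D | g x ≤ 0} :=
    interior_maximal (fun x hx => ⟨hx.1, le_of_lt hx.2⟩)
      (hD.inter (isOpen_lt hc continuous_const))
  rw [isOpen_interior.frontier_eq]
  ext x
  constructor
  · rintro ⟨hxc, hxi⟩
    have hxs : x ∈ closure {x ∈ D | g x ≤ 0} := closure_mono interior_subset hxc
    have hxD : x ∈ closure D := closure_mono (fun y hy => hy.1) hxs
    have hx0 : g x ≤ 0 :=
      closure_minimal (fun y hy => hy.2) (isClosed_le hc continuous_const) hxs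
    have hx : x ∈ D := by
      by_contra h
      exact absurd (hbd x (hD.frontier_eq ▸ ⟨hxD, h⟩)) hx0.not_gt
    exact ⟨hx, hx0.eq_of_not_lt fun h => hxi (hneg ⟨hx, h⟩)⟩
  · intro hx
    obtain ⟨hxD, hx0⟩ := hx
    refine ⟨?_, fun hxi => ?_⟩
    · by_contra h
      have hmin : IsLocalMin g x := by
        filter_upwards [isClosed_closure.isOpen_compl.mem_nhds h, hD.mem_nhds hxD] with y hy hyD
        rw [hx0]
        exact not_lt.mp fun hlt => hy (subset_closure (hneg ⟨hyD, hlt⟩))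
      exact hgrad x ⟨hxD, hx0⟩ hmin.fderiv_eq_zero
    · have hmax : IsLocalMax g x := by
        filter_upwards [mem_interior_iff_mem_nhds.mp hxi] with y hy
        rw [hx0]
        exact hy.2
      exact hgrad x ⟨hxD, hx0⟩ hmax.fderiv_eq_zero
end

section
/- Let T > 0, x₀ = (x₀¹, x₀²) ∈ ℝ², and let z = (z₁, z₂) : [0, 2T] → ℝ² be continuously differentiable with z(T) = x₀ and z₂′(T) ≠ 0. For each λ ≠ 0 in a punctured neighborhood of 0 let T_λ ∈ (0, 2T) and z_λ = (z₁^λ, z₂^λ) : [0, 2T] → ℝ² be continuously differentiable with z_λ(T_λ) = x₀. Assume T_λ → T as λ → 0, z_λ → z in C¹([0, 2T]; ℝ²) as λ → 0, and (z_λ − z)/λ → w = (w₁, w₂) in C¹([0, 2T]; ℝ²) as λ → 0. Then lim_{λ → 0} (T_λ − T)/λ = −w₂(T)/z₂′(T). -/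
/-- Differentiability of the period: if `z_λ(T_λ) = x₀ = z(T)`,
`T_λ → T`, `z_λ → z` in `C¹`, `(z_λ − z)/λ → w` in `C¹` and `z₂′(T) ≠ 0`, then
`(T_λ − T)/λ → −w₂(T)/z₂′(T)`. -/
theorem period_directional_derivative
    (T : ℝ) (hT : 0 < T) (x₀ : ℝ × ℝ)
    (z z' : ℝ → ℝ × ℝ)
    (hz : ∀ t ∈ Set.Icc (0 : ℝ) (2 * T), HasDerivAt z (z' t) t)
    (hz'c : ContinuousOn z' (Set.Icc (0 : ℝ) (2 * T)))
    (hzT : z T = x₀) (hz'T2 : (z' T).2 ≠ 0)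
    (Tl : ℝ → ℝ) (zl zl' : ℝ → ℝ → ℝ × ℝ) (lam₀ : ℝ) (hlam₀ : 0 < lam₀)
    (hzl : ∀ l : ℝ, l ≠ 0 → |l| < lam₀ →
      (∀ t ∈ Set.Icc (0 : ℝ) (2 * T), HasDerivAt (zl l) (zl' l t) t) ∧
      ContinuousOn (zl' l) (Set.Icc (0 : ℝ) (2 * T)) ∧
      Tl l ∈ Set.Ioo (0 : ℝ) (2 * T) ∧ zl l (Tl l) = x₀)
    (hTl : Filter.Tendsto Tl (nhdsWithin (0 : ℝ) {0}ᶜ) (nhds T))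
    (hc0 : TendstoUniformlyOn (fun l t => zl l t) z
      (nhdsWithin (0 : ℝ) {0}ᶜ) (Set.Icc 0 (2 * T)))
    (hc1 : TendstoUniformlyOn (fun l t => zl' l t) z'
      (nhdsWithin (0 : ℝ) {0}ᶜ) (Set.Icc 0 (2 * T)))
    (w w' : ℝ → ℝ × ℝ)
    (hw : ∀ t ∈ Set.Icc (0 : ℝ) (2 * T), HasDerivAt w (w' t) t)
    (hq0 : TendstoUniformlyOn (fun l t => l⁻¹ • (zl l t - z t)) w
      (nhdsWithin (0 : ℝ) {0}ᶜ) (Set.Icc 0 (2 * T)))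
    (hq1 : TendstoUniformlyOn (fun l t => l⁻¹ • (zl' l t - z' t)) w'
      (nhdsWithin (0 : ℝ) {0}ᶜ) (Set.Icc 0 (2 * T))) :
    Filter.Tendsto (fun l => (Tl l - T) / l) (nhdsWithin (0 : ℝ) {0}ᶜ)
      (nhds (-(w T).2 / (z' T).2)) := by
  have hmem : Set.Icc (0 : ℝ) (2 * T) ∈ nhds T := Icc_mem_nhds hT (by linarith)
  have hTI : T ∈ Set.Icc (0 : ℝ) (2 * T) := mem_of_mem_nhds hmem
  have hquot : Filter.Tendsto (fun l => l⁻¹ • (zl l (Tl l) - z (Tl l)))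
      (nhdsWithin (0 : ℝ) {0}ᶜ) (nhds (w T)) :=
    tendsto_comp_of_locally_uniform_limit (F := fun l t => l⁻¹ • (zl l t - z t))
      (hw T hTI).continuousAt hTl
      fun u hu => ⟨_, hmem, hq0 u hu⟩
  have hz2 : HasDerivAt (fun t => (z t).2) (z' T).2 T := (hz T hTI).snd
  have hslope : Filter.Tendsto (fun l => dslope (fun t => (z t).2) T (Tl l))
      (nhdsWithin (0 : ℝ) {0}ᶜ) (nhds (z' T).2) := by
    have h := (continuousAt_dslope_same.2 hz2.differentiableAt).tendsto.comp hTl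
    rwa [dslope_same, hz2.deriv] at h
  have hquot2 : Filter.Tendsto (fun l => (l⁻¹ • (zl l (Tl l) - z (Tl l))).2)
      (nhdsWithin (0 : ℝ) {0}ᶜ) (nhds (w T).2) :=
    (continuous_snd.tendsto _).comp hquot
  refine (hquot2.neg.div hslope hz'T2).congr' ?_
  have hsmall : ∀ᶠ l in nhdsWithin (0 : ℝ) {0}ᶜ, |l| < lam₀ :=
    nhdsWithin_le_nhds (continuous_abs.continuousAt.eventually_lt continuousAt_const (by simpa))
  filter_upwards [hsmall, self_mem_nhdsWithin, hslope.eventually_ne hz'T2] with l hl hl0 hs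
  have hend := (hzl l hl0 hl).2.2.2
  have hsub := sub_smul_dslope (fun t => (z t).2) T (Tl l)
  simp only [smul_eq_mul] at hsub
  have hl0' : l ≠ 0 := hl0
  simp only [Pi.div_apply, Prod.smul_snd, Prod.snd_sub, smul_eq_mul, hend, ← hzT]
  rw [div_eq_div_iff hs hl0', hsub]
  field_simp
  ring
end

section
/- Let D ⊂ ℝ² be a bounded open set and let V be a finite-dimensional subspace of real-valued functions on ℝ² each of which is continuously differentiable and bounded with bounded gradient on D. Let g, u : ℝ² → ℝ be bounded continuous functions and write g₊ = max(g, 0). Let F : V → ℝ be a linear map, and suppose p ∈ V satisfies ∫_D ∇φ · ∇p dx + ∫_D φ p dx = F(φ) for all φ ∈ V. Set v = −p and r = −p·u, and suppose q ∈ V satisfies ∫_D ∇q · ∇φ dx + ∫_D q φ dx = ∫_D (g₊² v + 2 g₊ u r) φ dx for all φ ∈ V. Then F(q) ≤ 0 (so the pair (r, v) is a descent direction for the discretized penalized cost). -/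
open scoped RealInnerProductSpace

/-- The choice `v = −p`, `r = −p u` (with `p` the discrete adjoint
state) gives a descent direction: the value `F(q)` of the adjoint right-hand side
functional at the corresponding discrete variation `q` of the state is `≤ 0`. -/
theorem descent_direction_finite_element
    (D : Set (EuclideanSpace ℝ (Fin 2))) (hD : IsOpen D)
    (hDb : Bornology.IsBounded D)
    (V : Submodule ℝ (EuclideanSpace ℝ (Fin 2) → ℝ)) (hVfd : FiniteDimensional ℝ V)
    (hVsm : ∀ φ ∈ V, ContDiff ℝ 1 φ)
    (hVbd : ∀ φ ∈ V, ∃ C : ℝ, ∀ x ∈ D, |φ x| ≤ C ∧ ‖gradient φ x‖ ≤ C)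
    (g u : EuclideanSpace ℝ (Fin 2) → ℝ)
    (hgc : Continuous g) (huc : Continuous u)
    (hgb : ∃ C : ℝ, ∀ x, |g x| ≤ C) (hub : ∃ C : ℝ, ∀ x, |u x| ≤ C)
    (F : V →ₗ[ℝ] ℝ) (p : V)
    (hp : ∀ φ : V,
      (∫ x in D, ⟪gradient (φ : EuclideanSpace ℝ (Fin 2) → ℝ) x,
          gradient (p : EuclideanSpace ℝ (Fin 2) → ℝ) x⟫)
        + (∫ x in D, (φ : EuclideanSpace ℝ (Fin 2) → ℝ) x
            * (p : EuclideanSpace ℝ (Fin 2) → ℝ) x) = F φ)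
    (q : V)
    (hq : ∀ φ : V,
      (∫ x in D, ⟪gradient (q : EuclideanSpace ℝ (Fin 2) → ℝ) x,
          gradient (φ : EuclideanSpace ℝ (Fin 2) → ℝ) x⟫)
        + (∫ x in D, (q : EuclideanSpace ℝ (Fin 2) → ℝ) x
            * (φ : EuclideanSpace ℝ (Fin 2) → ℝ) x)
        = ∫ x in D,
            ((max (g x) 0) ^ 2 * (-(p : EuclideanSpace ℝ (Fin 2) → ℝ) x)
              + 2 * max (g x) 0 * u x
                * (-((p : EuclideanSpace ℝ (Fin 2) → ℝ) x * u x)))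
            * (φ : EuclideanSpace ℝ (Fin 2) → ℝ) x) :
    F q ≤ 0 := by
  rw [← hp q, hq p]
  refine MeasureTheory.integral_nonpos fun x => ?_
  have hg : 0 ≤ max (g x) 0 := le_max_right _ _
  have hsq : 0 ≤ (max (g x) 0 * (p : EuclideanSpace ℝ (Fin 2) → ℝ) x) ^ 2 := sq_nonneg _
  have hup : 0 ≤ max (g x) 0 * (u x * (p : EuclideanSpace ℝ (Fin 2) → ℝ) x) ^ 2 :=
    mul_nonneg hg (sq_nonneg _)
  simp only [Pi.zero_apply]
  linarith
end
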